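/- Fix an integer p ≥ 1 and for each n let B_{P_2} := { (I, J) ∈ A_{2p} × A_{2p} : S_I ∩ S_J ≠ ∅ and every value occurring among the entries of I and J occurs, counted with multiplicity in the combined multiset S_I ∪ S_J, at least twice }. Then |B_{P_2}| = O(n^{2p−1}) as n → ∞. -/

import Mathlib

open Filter Asymptotics
open scoped BigOperators Classical

/-- The index set `A_{2p}`: tuples `(i_1, …, i_{2p})` with `1 ≤ i_k ≤ n` and
`Σ_{k=1}^{2p} (-1)^k i_k ≡ 0 (mod n)` (position `k : Fin (2p)` represents `i_{k+1}`,
so carries the sign `(-1)^{k+1}`). -/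
def ARCset (n p : ℕ) : Finset (Fin (2 * p) → ℕ) :=
  (Fintype.piFinset fun _ : Fin (2 * p) => Finset.Icc 1 n).filter fun I =>
    (∑ k : Fin (2 * p), (-1 : ℤ) ^ ((k : ℕ) + 1) * (I k : ℤ)) % (n : ℤ) = 0

/-- The number of occurrences of the value `x` among the entries of the two vectors `I, J`,
i.e. its multiplicity in the combined multiset `S_I ∪ S_J`. -/
def jointCount {p : ℕ} (I J : Fin (2 * p) → ℕ) (x : ℕ) : ℕ :=
  (Finset.univ.filter fun a => I a = x).card + (Finset.univ.filter fun b => J b = x).card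

/-- `B_{P_2}`: pairs `(I, J) ∈ A_{2p} × A_{2p}` forming a cluster (`S_I ∩ S_J ≠ ∅`) such that
every value occurring among the entries of `I` and `J` occurs at least twice in the
combined multiset `S_I ∪ S_J`. -/
noncomputable def BP2 (n p : ℕ) : Finset ((Fin (2 * p) → ℕ) × (Fin (2 * p) → ℕ)) :=
  ((ARCset n p) ×ˢ (ARCset n p)).filter fun IJ =>
    (∃ a b, IJ.1 a = IJ.2 b) ∧
      ∀ x : ℕ, ((∃ a, IJ.1 a = x) ∨ (∃ b, IJ.2 b = x)) → 2 ≤ jointCount IJ.1 IJ.2 x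

/-- The sum of all multiplicities of the values of `I` and `J` is the total number of entries. -/
theorem sum_jointCount {p : ℕ} (I J : Fin (2 * p) → ℕ) :
    ∑ x ∈ Finset.univ.image (Sum.elim I J), jointCount I J x = 2 * (2 * p) := by
  have hfiber (F : Fin (2 * p) → ℕ) (V : Finset ℕ) (hF : ∀ a, F a ∈ V) :
      ∑ x ∈ V, (Finset.univ.filter fun a => F a = x).card = 2 * p := by
    rw [← Finset.card_eq_sum_card_fiberwise fun a _ => hF a]
    simp
  simp only [jointCount, Finset.sum_add_distrib]
  rw [hfiber I _ fun a => Finset.mem_image.2 ⟨Sum.inl a, by simp⟩,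
    hfiber J _ fun b => Finset.mem_image.2 ⟨Sum.inr b, by simp⟩]
  ring

/-- The pairs in `BP2 n p` whose entries are constant on the fibers of `f`, where the fiber of `i`
is either empty or meets the positions of the first vector exactly once. -/
noncomputable def fiberClass (n p : ℕ) (f : Fin (2 * p) ⊕ Fin (2 * p) → Fin (2 * p))
    (i : Fin (2 * p)) : Finset ((Fin (2 * p) → ℕ) × (Fin (2 * p) → ℕ)) :=
  (BP2 n p).filter fun IJ =>
    (∀ s t, f s = f t → Sum.elim IJ.1 IJ.2 s = Sum.elim IJ.1 IJ.2 t) ∧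
      ((∀ s, f s ≠ i) ∨ ∃ a, f (Sum.inl a) = i ∧ ∀ a', f (Sum.inl a') = i → a' = a)

theorem BP2_subset_biUnion_fiberClass (n p : ℕ) :
    BP2 n p ⊆ Finset.univ.biUnion
      fun fi : (Fin (2 * p) ⊕ Fin (2 * p) → Fin (2 * p)) × Fin (2 * p) =>
        fiberClass n p fi.1 fi.2 := by
  rintro ⟨I, J⟩ hIJ
  obtain ⟨-, ⟨a, b, hab⟩, htwo⟩ := Finset.mem_filter.1 hIJ
  simp only at hab htwo
  set V := Finset.univ.image (Sum.elim I J) with hV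
  have hmem (s) : Sum.elim I J s ∈ V := Finset.mem_image_of_mem _ (Finset.mem_univ s)
  have htwoV : ∀ x ∈ V, 2 ≤ jointCount I J x := by
    intro x hx
    obtain ⟨s | s, -, rfl⟩ := Finset.mem_image.1 hx
    · exact htwo _ (Or.inl ⟨s, rfl⟩)
    · exact htwo _ (Or.inr ⟨s, rfl⟩)
  have hsum := sum_jointCount I J
  have hcard : V.card ≤ 2 * p := by
    have := Finset.card_nsmul_le_sum V _ 2 htwoV
    rw [hsum, smul_eq_mul] at this
    omega
  obtain ⟨e⟩ : Nonempty (V ↪ Fin (2 * p)) :=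
    Function.Embedding.nonempty_of_card_le (by simpa using hcard)
  simp only [Finset.mem_biUnion, Finset.mem_univ, true_and, Prod.exists, fiberClass,
    Finset.mem_filter]
  have hker (s t) (h : e ⟨_, hmem s⟩ = e ⟨_, hmem t⟩) : Sum.elim I J s = Sum.elim I J t :=
    congrArg Subtype.val (e.injective h)
  by_cases hsurj : Function.Surjective e
  · refine ⟨fun s => e ⟨_, hmem s⟩, e ⟨_, hmem (Sum.inl a)⟩, hIJ, hker, Or.inr ⟨a, rfl, ?_⟩⟩
    have hcard' : 2 * p = V.card := by
      have := Fintype.card_le_of_surjective e hsurj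
      simp only [Fintype.card_fin, Fintype.card_coe] at this
      omega
    have hexact : ∀ x ∈ V, 2 = jointCount I J x := by
      rw [← Finset.sum_eq_sum_iff_of_le htwoV, hsum, Finset.sum_const, smul_eq_mul]
      omega
    have hx : 2 = (Finset.univ.filter fun a' => I a' = I a).card +
        (Finset.univ.filter fun b => J b = I a).card := hexact _ (hmem (Sum.inl a))
    have hJ : 0 < (Finset.univ.filter fun b => J b = I a).card :=
      Finset.card_pos.2 ⟨b, by simp [hab]⟩
    have hI : (Finset.univ.filter fun a' => I a' = I a).card ≤ 1 := by omega
    intro a' ha'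
    exact Finset.card_le_one.1 hI a' (by simpa using hker _ _ ha') a (by simp)
  · simp only [Function.Surjective, not_forall, not_exists] at hsurj
    obtain ⟨i, hi⟩ := hsurj
    exact ⟨fun s => e ⟨_, hmem s⟩, i, hIJ, hker, Or.inl fun s => hi _⟩

/-- Two members of `ARCset n p` that agree at all but one position are equal. -/
theorem ARCset_eq_of_eq_off {n p : ℕ} {I I' : Fin (2 * p) → ℕ} (hI : I ∈ ARCset n p)
    (hI' : I' ∈ ARCset n p) (a : Fin (2 * p)) (h : ∀ a', a' ≠ a → I a' = I' a') :
    I a = I' a := by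
  obtain ⟨hr, hs⟩ := Finset.mem_filter.1 hI
  obtain ⟨hr', hs'⟩ := Finset.mem_filter.1 hI'
  have hra := Finset.mem_Icc.1 (Fintype.mem_piFinset.1 hr a)
  have hra' := Finset.mem_Icc.1 (Fintype.mem_piFinset.1 hr' a)
  have hdvd := dvd_sub (Int.dvd_of_emod_eq_zero hs) (Int.dvd_of_emod_eq_zero hs')
  rw [← Finset.sum_sub_distrib, Finset.sum_eq_single a (fun k _ hk => by rw [h k hk, sub_self])
    (by simp), ← mul_sub, (isUnit_neg_one.pow _).dvd_mul_left] at hdvd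
  have := Int.eq_zero_of_abs_lt_dvd hdvd (by rw [abs_lt]; omega)
  omega

theorem card_fiberClass_le {n p : ℕ} (hn : 1 ≤ n) (f : Fin (2 * p) ⊕ Fin (2 * p) → Fin (2 * p))
    (i : Fin (2 * p)) : (fiberClass n p f i).card ≤ n ^ (2 * p - 1) := by
  let restrict : (Fin (2 * p) → ℕ) × (Fin (2 * p) → ℕ) → {j // j ≠ i} → ℕ := fun IJ j =>
    if h : ∃ s, f s = j then Sum.elim IJ.1 IJ.2 h.choose else 1
  have hcard : (Fintype.piFinset fun _ : {j // j ≠ i} => Finset.Icc 1 n).card = n ^ (2 * p - 1) := by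
    simp [Fintype.card_subtype_compl]
  rw [← hcard]
  refine Finset.card_le_card_of_injOn restrict ?_ ?_
  · rintro ⟨I, J⟩ hIJ
    obtain ⟨hA, -⟩ := Finset.mem_filter.1 (Finset.mem_filter.1 hIJ).1
    obtain ⟨hI, hJ⟩ := Finset.mem_product.1 hA
    have hrange (s) : Sum.elim I J s ∈ Finset.Icc 1 n := by
      cases s with
      | inl s => exact Fintype.mem_piFinset.1 (Finset.mem_filter.1 hI).1 s
      | inr s => exact Fintype.mem_piFinset.1 (Finset.mem_filter.1 hJ).1 s
    refine Fintype.mem_piFinset.2 fun j => ?_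
    simp only [restrict]
    split_ifs
    · exact hrange _
    · exact Finset.mem_Icc.2 ⟨le_rfl, hn⟩
  · rintro ⟨I, J⟩ hIJ ⟨I', J'⟩ hIJ' heq
    obtain ⟨hB, hker, hi⟩ := Finset.mem_filter.1 hIJ
    obtain ⟨hB', hker', -⟩ := Finset.mem_filter.1 hIJ'
    have hI := (Finset.mem_product.1 (Finset.mem_filter.1 hB).1).1
    have hI' := (Finset.mem_product.1 (Finset.mem_filter.1 hB').1).1
    simp only at hker hker' hI hI'
    have hoff (s) (hs : f s ≠ i) : Sum.elim I J s = Sum.elim I' J' s := by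
      have hex : ∃ t, f t = f s := ⟨s, rfl⟩
      have := congrFun heq ⟨f s, hs⟩
      simp only [restrict, dif_pos hex] at this
      rwa [hker _ _ hex.choose_spec, hker' _ _ hex.choose_spec] at this
    have hall : Sum.elim I J = Sum.elim I' J' := by
      ext s
      by_cases hs : f s = i
      · rcases hi with hi | ⟨a, ha, huniq⟩
        · exact absurd hs (hi s)
        · rw [hker s (Sum.inl a) (hs.trans ha.symm), hker' s (Sum.inl a) (hs.trans ha.symm)]
          exact ARCset_eq_of_eq_off hI hI' a fun a' ha' =>
            hoff (Sum.inl a') fun h => ha' (huniq a' h)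
      · exact hoff s hs
    exact Prod.ext (congrArg (· ∘ Sum.inl) hall) (congrArg (· ∘ Sum.inr) hall)

/-- `|B_{P_2}| = O(n^{2p-1})` as `n → ∞`. -/
theorem bp2_card_bigO (p : ℕ) (hp : 1 ≤ p) :
    (fun n : ℕ => ((BP2 n p).card : ℝ)) =O[atTop] fun n : ℕ => (n : ℝ) ^ (2 * p - 1) := by
  refine IsBigO.of_bound
    (Fintype.card ((Fin (2 * p) ⊕ Fin (2 * p) → Fin (2 * p)) × Fin (2 * p)) : ℝ) ?_
  filter_upwards [eventually_ge_atTop 1] with n hn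
  have hle := (Finset.card_le_card (BP2_subset_biUnion_fiberClass n p)).trans
    (Finset.card_biUnion_le_card_mul _ _ _ fun fi _ => card_fiberClass_le hn fi.1 fi.2)
  rw [Finset.card_univ] at hle
  rw [Real.norm_of_nonneg (by positivity), Real.norm_of_nonneg (by positivity)]
  exact_mod_cast hle
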